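/- Let W be a standard one-dimensional Brownian motion with natural filtration (F_t), let x ∈ ℝ, and set X(s) = x + W(s) (the Cox–Ingersoll–Ross squared-Bessel factor with b ≡ 0, σ ≡ 1, d = 1, so that r(s) = X(s)²). Then for all 0 ≤ t ≤ T, writing τ = T − t: E[exp(−∫_t^T X(s)² ds) | F_t] = (sech(√2·τ))^{1/2} · exp(−(X(t)²/√2)·tanh(√2·τ)) almost surely, where the integral ∫_t^T X(s)² ds is defined pathwise. -/

import Mathlib

open MeasureTheory ProbabilityTheory

/-- The natural filtration of a real-valued process `W`: the σ-algebra generated by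
`W s` for all `s ≤ t`. -/
def natFilt {Ω : Type*} (W : ℝ → Ω → ℝ) (t : ℝ) : MeasurableSpace Ω :=
  ⨆ s ∈ Set.Iic t, MeasurableSpace.comap (W s) (inferInstance : MeasurableSpace ℝ)

/-- `W` is a standard one-dimensional Brownian motion on `(Ω, P)`: it starts at `0`, has
continuous sample paths, is measurable, its increments `W t - W s` (for `0 ≤ s ≤ t`) are
centered Gaussian with variance `t - s`, and these increments are independent of the natural
filtration at time `s`. -/
def IsStdBrownian {Ω : Type*} [MeasurableSpace Ω] (P : Measure Ω) (W : ℝ → Ω → ℝ) : Prop :=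
  (∀ ω, W 0 ω = 0) ∧
  (∀ ω, Continuous fun s => W s ω) ∧
  (∀ t : ℝ, Measurable (W t)) ∧
  (∀ s t : ℝ, 0 ≤ s → s ≤ t →
    Measure.map (fun ω => W t ω - W s ω) P = gaussianReal 0 (Real.toNNReal (t - s))) ∧
  (∀ s t : ℝ, 0 ≤ s → s ≤ t →
    Indep (MeasurableSpace.comap (fun ω => W t ω - W s ω)
      (inferInstance : MeasurableSpace ℝ)) (natFilt W s) P)

lemma gauss_quad (β h y : ℝ) (hβ : 0 ≤ β) (hh : 0 < h) :
    ∫ z, Real.exp (-β * (y + z) ^ 2) ∂(gaussianReal 0 (Real.toNNReal h)) =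
      (1 / (1 + 2 * β * h)) ^ ((1 : ℝ) / 2) * Real.exp (-(β / (1 + 2 * β * h)) * y ^ 2) := by
  have hv : Real.toNNReal h ≠ 0 := by simpa using hh
  rw [integral_gaussianReal_eq_integral_smul hv]
  have hD : 0 < 1 + 2 * β * h := by positivity
  set b : ℝ := (1 + 2 * β * h) / (2 * h) with hb
  have hb0 : 0 < b := by positivity
  have key : ∀ z : ℝ, gaussianPDFReal 0 (Real.toNNReal h) z • Real.exp (-β * (y + z) ^ 2) =
      ((Real.sqrt (2 * Real.pi * h))⁻¹ * Real.exp (-(β / (1 + 2 * β * h)) * y ^ 2)) *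
        Real.exp (-b * (z + β * y / b) ^ 2) := by
    intro z
    rw [gaussianPDFReal, smul_eq_mul, Real.coe_toNNReal _ hh.le]
    simp only [mul_assoc (Real.sqrt (2 * Real.pi * h))⁻¹, ← Real.exp_add]
    congr 2
    rw [hb]
    field_simp
    ring
  simp_rw [key]
  rw [integral_const_mul, integral_add_right_eq_self (fun z => Real.exp (-b * z ^ 2)),
    integral_gaussian, ← Real.sqrt_eq_rpow, mul_right_comm]
  congr 1
  rw [← Real.sqrt_inv, ← Real.sqrt_mul (by positivity)]
  congr 1
  rw [hb]
  field_simp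

lemma natFilt_le {Ω : Type*} [m : MeasurableSpace Ω] (W : ℝ → Ω → ℝ)
    (hm : ∀ t, Measurable (W t)) (t : ℝ) : natFilt W t ≤ m :=
  iSup₂_le fun s _ => (hm s).comap_le

lemma natFilt_mono {Ω : Type*} (W : ℝ → Ω → ℝ) {s t : ℝ} (h : s ≤ t) :
    natFilt W s ≤ natFilt W t :=
  iSup₂_le fun r hr =>
    le_iSup₂_of_le (f := fun (s : ℝ) (_ : s ∈ Set.Iic t) =>
      MeasurableSpace.comap (W s) (inferInstance : MeasurableSpace ℝ))
      r (le_trans hr h) le_rfl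

lemma natFilt_meas {Ω : Type*} (W : ℝ → Ω → ℝ) (t : ℝ) :
    Measurable[natFilt W t] (W t) := by
  rw [measurable_iff_comap_le]
  exact le_iSup₂_of_le (f := fun (s : ℝ) (_ : s ∈ Set.Iic t) =>
      MeasurableSpace.comap (W s) (inferInstance : MeasurableSpace ℝ)) t (Set.mem_Iic.2 le_rfl) le_rfl

lemma one_step {Ω : Type*} [MeasurableSpace Ω] (P : Measure Ω)
    [IsProbabilityMeasure P] (W : ℝ → Ω → ℝ) (hW : IsStdBrownian P W) (x s h β : ℝ)
    (hs : 0 ≤ s) (hh : 0 < h) (hβ : 0 ≤ β) (ξ : Ω → ℝ) (hξ : Measurable[natFilt W s] ξ)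
    (hξ1 : ∀ ω, |ξ ω| ≤ 1) :
    ∫ ω, ξ ω * Real.exp (-β * (x + W (s + h) ω) ^ 2) ∂P =
      ∫ ω, ξ ω * ((1 / (1 + 2 * β * h)) ^ ((1 : ℝ) / 2) *
        Real.exp (-(β / (1 + 2 * β * h)) * (x + W s ω) ^ 2)) ∂P := by
  obtain ⟨h0, hc, hm, hg, hi⟩ := hW
  have hle := natFilt_le W hm s
  have hξm : Measurable ξ := hξ.mono hle le_rfl
  set Z : Ω → ℝ := fun ω => W (s + h) ω - W s ω with hZ
  have hZm : Measurable Z := (hm _).sub (hm _)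
  set Y : Ω → ℝ × ℝ := fun ω => (ξ ω, x + W s ω) with hY
  have hYm' : Measurable[natFilt W s] Y := by
    refine Measurable.prodMk hξ ?_
    exact (natFilt_meas W s).const_add x
  have hYm : Measurable Y := hYm'.mono hle le_rfl
  have hind : IndepFun Y Z P := by
    rw [IndepFun_iff_Indep]
    exact (indep_of_indep_of_le_right (hi s (s + h) hs (by linarith)) hYm'.comap_le).symm
  have hmap := (indepFun_iff_map_prod_eq_prod_map_map hYm.aemeasurable hZm.aemeasurable).1 hind
  have hZg : Measure.map Z P = gaussianReal 0 (Real.toNNReal h) := by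
    have := hg s (s + h) hs (by linarith)
    rwa [add_sub_cancel_left] at this
  rw [hZg] at hmap
  let G : (ℝ × ℝ) × ℝ → ℝ := fun p => p.1.1 * Real.exp (-β * (p.1.2 + p.2) ^ 2)
  have hGm : Measurable G := by fun_prop
  have e1 : ∀ ω, ξ ω * Real.exp (-β * (x + W (s + h) ω) ^ 2) = G (Y ω, Z ω) := by
    intro ω
    simp only [G, hY, hZ]
    congr 3
    ring
  have hint : Integrable G ((Measure.map Y P).prod (gaussianReal 0 (Real.toNNReal h))) := by
    rw [← hmap, integrable_map_measure hGm.aestronglyMeasurable (hYm.prodMk hZm).aemeasurable]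
    refine Integrable.of_bound (hGm.comp (hYm.prodMk hZm)).aestronglyMeasurable 1
      (Filter.Eventually.of_forall fun ω => ?_)
    simp only [Function.comp, G, hY, Real.norm_eq_abs, abs_mul, Real.abs_exp]
    refine mul_le_one₀ (hξ1 ω) (Real.exp_pos _).le (Real.exp_le_one_iff.2 ?_)
    have : 0 ≤ β * (x + W s ω + Z ω) ^ 2 := by positivity
    linarith
  simp_rw [e1]
  rw [← integral_map (φ := fun ω => (Y ω, Z ω)) (hYm.prodMk hZm).aemeasurable
    hGm.aestronglyMeasurable, hmap, integral_prod _ hint]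
  simp only [G, integral_const_mul, gauss_quad β h _ hβ hh]
  rw [integral_map hYm.aemeasurable]
  exact (by fun_prop : Measurable _).aestronglyMeasurable

/-- the discretised discount factor -/
noncomputable def discF {Ω : Type*} (W : ℝ → Ω → ℝ) (x h c : ℝ) (n : ℕ) (s : ℝ) (ω : Ω) : ℝ :=
  Real.exp (-(c * ∑ i ∈ Finset.range n, (x + W (s + i * h) ω) ^ 2
    + c / 2 * (x + W (s + n * h) ω) ^ 2))

lemma discF_zero {Ω : Type*} (W : ℝ → Ω → ℝ) (x h c s : ℝ) (ω : Ω) :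
    discF W x h c 0 s ω = Real.exp (-(c / 2) * (x + W s ω) ^ 2) := by
  simp [discF]

lemma discF_succ {Ω : Type*} (W : ℝ → Ω → ℝ) (x h c s : ℝ) (n : ℕ) (ω : Ω) :
    discF W x h c (n + 1) s ω =
      Real.exp (-c * (x + W s ω) ^ 2) * discF W x h c n (s + h) ω := by
  rw [discF, discF, ← Real.exp_add, Finset.sum_range_succ']
  congr 1
  have : ∀ i : ℕ, s + ((i + 1 : ℕ) : ℝ) * h = s + h + i * h := by
    intro i; push_cast; ring
  simp_rw [this]
  simp
  ring

lemma cosh_three (a b : ℝ) :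
    Real.cosh (a + b) + Real.cosh (a - b) = 2 * Real.cosh a * Real.cosh b := by
  rw [Real.cosh_add, Real.cosh_sub]; ring

lemma disc_formula {Ω : Type*} [MeasurableSpace Ω] (P : Measure Ω)
    [IsProbabilityMeasure P] (W : ℝ → Ω → ℝ) (hW : IsStdBrownian P W) (x h : ℝ)
    (hh : 0 < h) (n : ℕ) : ∀ (s : ℝ) (_ : 0 ≤ s) (ξ : Ω → ℝ) (_ : Measurable[natFilt W s] ξ)
    (_ : ∀ ω, |ξ ω| ≤ 1),
    ∫ ω, ξ ω * discF W x h ((Real.cosh (Real.sqrt 2 * h) - 1) / h) n s ω ∂P =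
      ∫ ω, ξ ω * ((1 / Real.cosh (Real.sqrt 2 * (n * h))) ^ ((1 : ℝ) / 2) *
        Real.exp (-((Real.cosh (Real.sqrt 2 * (n * h + h)) - Real.cosh (Real.sqrt 2 * (n * h)))
          / (2 * h * Real.cosh (Real.sqrt 2 * (n * h)))) * (x + W s ω) ^ 2)) ∂P := by
  set c := (Real.cosh (Real.sqrt 2 * h) - 1) / h with hc
  have hc0 : 0 ≤ c := div_nonneg (by linarith [Real.one_le_cosh (Real.sqrt 2 * h)]) hh.le
  induction n with
  | zero =>
    intro s hs ξ hξ hξ1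
    simp only [discF_zero]
    congr 1; ext ω
    simp [hc]
    left; left
    field_simp
  | succ n ih =>
    intro s hs ξ hξ hξ1
    simp only [discF_succ]
    have hXm := natFilt_meas W s
    have hξ' : Measurable[natFilt W s] (fun ω => ξ ω * Real.exp (-c * (x + W s ω) ^ 2)) := by
      refine hξ.mul (Real.measurable_exp.comp ?_)
      exact ((hXm.const_add x).pow_const 2).const_mul (-c)
    have hξ1' : ∀ ω, |ξ ω * Real.exp (-c * (x + W s ω) ^ 2)| ≤ 1 := by
      intro ω
      rw [abs_mul, Real.abs_exp]
      refine mul_le_one₀ (hξ1 ω) (Real.exp_pos _).le (Real.exp_le_one_iff.2 ?_)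
      have : 0 ≤ c * (x + W s ω) ^ 2 := by positivity
      linarith
    have h1 := ih (s + h) (by linarith) _
      (hξ'.mono (natFilt_mono W (by linarith : s ≤ s + h)) le_rfl) hξ1'
    simp only [← mul_assoc (ξ _)] at h1 ⊢
    rw [h1]
    set C0 := Real.cosh (Real.sqrt 2 * (n * h)) with hC0
    set C1 := Real.cosh (Real.sqrt 2 * (n * h + h)) with hC1
    have hC0p : 0 < C0 := Real.cosh_pos _
    have hC1p : 0 < C1 := Real.cosh_pos _
    have hle : C0 ≤ C1 := by
      rw [hC0, hC1, Real.cosh_le_cosh, abs_of_nonneg (by positivity), abs_of_nonneg (by positivity)]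
      have := Real.sqrt_nonneg 2
      nlinarith
    have hβ : 0 ≤ (C1 - C0) / (2 * h * C0) := div_nonneg (by linarith) (by positivity)
    have h2 := one_step P W hW x s h ((C1 - C0) / (2 * h * C0)) hs hh hβ _ hξ' hξ1'
    have e2 : 1 + 2 * ((C1 - C0) / (2 * h * C0)) * h = C1 / C0 := by
      field_simp; ring
    rw [e2] at h2
    have hn : ((n + 1 : ℕ) : ℝ) * h = n * h + h := by push_cast; ring
    rw [hn, ← hC1]
    set C2 := Real.cosh (Real.sqrt 2 * (n * h + h + h)) with hC2
    have h3 : C2 + C0 = 2 * C1 * Real.cosh (Real.sqrt 2 * h) := by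
      rw [hC0, hC1, hC2, ← cosh_three]; congr 2 <;> ring
    have e3 : ∀ ω, ξ ω * Real.exp (-c * (x + W s ω) ^ 2) * ((1 / C0) ^ ((1 : ℝ) / 2) *
        Real.exp (-((C1 - C0) / (2 * h * C0)) * (x + W (s + h) ω) ^ 2)) =
        (1 / C0) ^ ((1 : ℝ) / 2) * (ξ ω * Real.exp (-c * (x + W s ω) ^ 2) *
        Real.exp (-((C1 - C0) / (2 * h * C0)) * (x + W (s + h) ω) ^ 2)) := by
      intro ω; ring
    simp_rw [e3]
    rw [integral_const_mul, h2, ← integral_const_mul]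
    congr 1; ext ω
    have e4 : (1 / C1) ^ ((1 : ℝ) / 2) = (1 / C0) ^ ((1 : ℝ) / 2) * (1 / (C1 / C0)) ^ ((1 : ℝ) / 2) := by
      rw [← Real.mul_rpow (by positivity) (by positivity)]
      congr 1
      field_simp
    have e5 : Real.exp (-((C2 - C1) / (2 * h * C1)) * (x + W s ω) ^ 2) =
        Real.exp (-c * (x + W s ω) ^ 2) *
        Real.exp (-((C1 - C0) / (2 * h * C0) / (C1 / C0)) * (x + W s ω) ^ 2) := by
      rw [← Real.exp_add]
      congr 1
      have : C2 = 2 * C1 * Real.cosh (Real.sqrt 2 * h) - C0 := by linarith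
      rw [this, hc]
      field_simp
      ring
    rw [e4, e5]
    ring

lemma riemann_tendsto (f : ℝ → ℝ) (hf : Continuous f) (t T : ℝ) (htT : t < T) :
    Filter.Tendsto (fun n : ℕ => ((T - t) / (n + 1 : ℕ)) *
      ∑ i ∈ Finset.range (n + 1), f (t + i * ((T - t) / (n + 1 : ℕ))))
      Filter.atTop (nhds (∫ s in t..T, f s)) := by
  have huc : UniformContinuousOn f (Set.Icc t T) :=
    isCompact_Icc.uniformContinuousOn_of_continuous hf.continuousOn
  rw [Metric.uniformContinuousOn_iff_le] at huc
  rw [Metric.tendsto_atTop]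
  intro ε hε
  obtain ⟨δ, hδ, hu⟩ := huc (ε / (2 * (T - t))) (by have := sub_pos.2 htT; positivity)
  obtain ⟨N, hN⟩ := exists_nat_gt ((T - t) / δ)
  refine ⟨N, fun n hn => ?_⟩
  have hTt := sub_pos.2 htT
  have hn1 : (0 : ℝ) < ((n + 1 : ℕ) : ℝ) := by positivity
  set h := (T - t) / ((n + 1 : ℕ) : ℝ) with hh
  have hh0 : 0 < h := by positivity
  have hhn : ((n + 1 : ℕ) : ℝ) * h = T - t := by rw [hh]; field_simp
  have hhδ : h ≤ δ := by
    rw [hh, div_le_iff₀ hn1]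
    rw [div_lt_iff₀ hδ] at hN
    have : (N : ℝ) ≤ ((n + 1 : ℕ) : ℝ) := by exact_mod_cast (by omega : N ≤ n + 1)
    nlinarith
  have hsum := intervalIntegral.sum_integral_adjacent_intervals (f := f) (μ := volume)
    (a := fun i : ℕ => t + i * h) (n := n + 1) (fun k _ => hf.intervalIntegrable _ _)
  have hend : t + ((n + 1 : ℕ) : ℝ) * h = T := by linarith
  simp only [hend] at hsum
  simp only [Nat.cast_zero, zero_mul, add_zero] at hsum
  rw [← hsum, Real.dist_eq, Finset.mul_sum, ← Finset.sum_sub_distrib]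
  have hb : ∀ i ∈ Finset.range (n + 1),
      |h * f (t + i * h) - ∫ s in (t + i * h)..(t + ((i + 1 : ℕ) : ℝ) * h), f s|
        ≤ ε / (2 * (T - t)) * h := by
    intro i hi
    have hi' : ((i + 1 : ℕ) : ℝ) ≤ ((n + 1 : ℕ) : ℝ) := by
      exact_mod_cast Finset.mem_range.1 hi
    have hlen : t + ((i + 1 : ℕ) : ℝ) * h - (t + i * h) = h := by push_cast; ring
    have e : h * f (t + i * h) - ∫ s in (t + i * h)..(t + ((i + 1 : ℕ) : ℝ) * h), f s =
        ∫ s in (t + i * h)..(t + ((i + 1 : ℕ) : ℝ) * h), (f (t + i * h) - f s) := by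
      rw [intervalIntegral.integral_sub (by simp) (hf.intervalIntegrable _ _),
        intervalIntegral.integral_const, hlen, smul_eq_mul]
    rw [e, ← Real.norm_eq_abs]
    have := intervalIntegral.norm_integral_le_of_norm_le_const
      (f := fun s => f (t + i * h) - f s) (C := ε / (2 * (T - t)))
      (a := t + i * h) (b := t + ((i + 1 : ℕ) : ℝ) * h) ?_
    · rwa [hlen, abs_of_pos hh0] at this
    · intro s hs
      rw [Set.uIoc_of_le (by linarith)] at hs
      have hup : t + ((i + 1 : ℕ) : ℝ) * h ≤ T := by nlinarith
      have hlow : 0 ≤ (i : ℝ) * h := by positivity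
      rw [← dist_eq_norm]
      refine hu _ ⟨by linarith, by linarith [hs.1, hs.2]⟩ _ ⟨by linarith [hs.1], by linarith [hs.2]⟩ ?_
      rw [Real.dist_eq, abs_sub_comm, abs_of_nonneg (by linarith [hs.1])]
      linarith [hs.2]
  calc _ ≤ ∑ i ∈ Finset.range (n + 1), _ := Finset.abs_sum_le_sum_abs _ _
    _ ≤ ∑ i ∈ Finset.range (n + 1), ε / (2 * (T - t)) * h := Finset.sum_le_sum hb
    _ = ε / (2 * (T - t)) * (((n + 1 : ℕ) : ℝ) * h) := by
      rw [Finset.sum_const, Finset.card_range, nsmul_eq_mul]; ring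
    _ = ε / 2 := by rw [hhn]; field_simp
    _ < ε := by linarith

lemma coef_tendsto : Filter.Tendsto
    (fun h : ℝ => (Real.cosh (Real.sqrt 2 * h) - 1) / h / h) (nhdsWithin 0 {0}ᶜ) (nhds 1) := by
  have hd : HasDerivAt (fun h : ℝ => Real.sinh (Real.sqrt 2 / 2 * h)) (Real.sqrt 2 / 2) 0 := by
    have h1 : HasDerivAt (fun h : ℝ => Real.sqrt 2 / 2 * h) (Real.sqrt 2 / 2) 0 := by
      simpa using (hasDerivAt_id (0 : ℝ)).const_mul (Real.sqrt 2 / 2)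
    simpa using h1.sinh
  have h2 := (hasDerivAt_iff_tendsto_slope_zero.1 hd).pow 2 |>.const_mul 2
  have hs : Real.sqrt 2 ^ 2 = 2 := Real.sq_sqrt (by norm_num)
  have e : 2 * (Real.sqrt 2 / 2) ^ 2 = 1 := by rw [div_pow, hs]; norm_num
  rw [e] at h2
  refine h2.congr' ?_
  filter_upwards [self_mem_nhdsWithin] with h hh
  have hh' : h ≠ 0 := hh
  have : Real.cosh (Real.sqrt 2 * h) = 2 * Real.sinh (Real.sqrt 2 / 2 * h) ^ 2 + 1 := by
    rw [show Real.sqrt 2 * h = 2 * (Real.sqrt 2 / 2 * h) by ring, Real.cosh_two_mul,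
      Real.cosh_sq]
    ring
  rw [this]
  simp
  field_simp

lemma slope_tendsto (τ : ℝ) : Filter.Tendsto
    (fun h : ℝ => (Real.cosh (Real.sqrt 2 * (τ + h)) - Real.cosh (Real.sqrt 2 * τ)) /
      (2 * h * Real.cosh (Real.sqrt 2 * τ))) (nhdsWithin 0 {0}ᶜ)
      (nhds (Real.tanh (Real.sqrt 2 * τ) / Real.sqrt 2)) := by
  have hd : HasDerivAt (fun h : ℝ => Real.cosh (Real.sqrt 2 * h))
      (Real.sinh (Real.sqrt 2 * τ) * Real.sqrt 2) τ := by
    have h1 : HasDerivAt (fun h : ℝ => Real.sqrt 2 * h) (Real.sqrt 2) τ := by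
      simpa using (hasDerivAt_id τ).const_mul (Real.sqrt 2)
    exact h1.cosh
  have h2 := (hasDerivAt_iff_tendsto_slope_zero.1 hd).div_const (2 * Real.cosh (Real.sqrt 2 * τ))
  have hs : Real.sqrt 2 ^ 2 = 2 := Real.sq_sqrt (by norm_num)
  have hc : 0 < Real.cosh (Real.sqrt 2 * τ) := Real.cosh_pos _
  have hs0 : 0 < Real.sqrt 2 := by positivity
  have e : Real.sinh (Real.sqrt 2 * τ) * Real.sqrt 2 / (2 * Real.cosh (Real.sqrt 2 * τ)) =
      Real.tanh (Real.sqrt 2 * τ) / Real.sqrt 2 := by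
    rw [Real.tanh_eq_sinh_div_cosh]
    field_simp
    rw [hs]
    ring
  rw [e] at h2
  refine h2.congr' ?_
  filter_upwards [self_mem_nhdsWithin] with h hh
  have hh' : h ≠ 0 := hh
  rw [smul_eq_mul]
  field_simp

lemma step_tendsto (τ : ℝ) (hτ : 0 < τ) : Filter.Tendsto (fun n : ℕ => τ / (n + 1 : ℕ))
    Filter.atTop (nhdsWithin 0 {0}ᶜ) := by
  refine tendsto_nhdsWithin_iff.2 ⟨?_, Filter.Eventually.of_forall fun n => ?_⟩
  · exact (tendsto_const_div_atTop_nhds_zero_nat τ).comp (Filter.tendsto_add_atTop_nat 1)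
  · have : τ / (n + 1 : ℕ) ≠ 0 := by positivity
    exact this

lemma discF_tendsto {Ω : Type*} (W : ℝ → Ω → ℝ) (x t T : ℝ) (htT : t < T) (ω : Ω)
    (hc : Continuous fun s => W s ω) :
    Filter.Tendsto (fun n : ℕ => discF W x ((T - t) / (n + 1 : ℕ))
      ((Real.cosh (Real.sqrt 2 * ((T - t) / (n + 1 : ℕ))) - 1) / ((T - t) / (n + 1 : ℕ)))
      (n + 1) t ω) Filter.atTop (nhds (Real.exp (-∫ s in t..T, (x + W s ω) ^ 2))) := by
  have hτ := sub_pos.2 htT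
  have hst := step_tendsto (T - t) hτ
  have h1 := coef_tendsto.comp hst
  have h2 := riemann_tendsto (fun s => (x + W s ω) ^ 2) (by fun_prop) t T htT
  have h3 := ((h1.mul (tendsto_nhds_of_tendsto_nhdsWithin hst)).div_const 2).mul_const
    ((x + W T ω) ^ 2)
  have h4 := ((h1.mul h2).add h3).neg
  simp only [one_mul, zero_div, mul_zero, zero_mul, add_zero] at h4
  refine ((Real.continuous_exp.tendsto _).comp h4).congr fun n => ?_
  have hn : ((n + 1 : ℕ) : ℝ) ≠ 0 := by positivity
  have hend : t + ((n + 1 : ℕ) : ℝ) * ((T - t) / ((n + 1 : ℕ) : ℝ)) = T := by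
    field_simp; ring
  simp only [discF, Function.comp, hend]
  have hh : (T - t) / ((n + 1 : ℕ) : ℝ) ≠ 0 := by positivity
  set h := (T - t) / ((n + 1 : ℕ) : ℝ)
  congr 2
  rw [← mul_assoc, div_mul_cancel₀ _ hh]

/-- CIR model with `b ≡ 0`, `σ ≡ 1`, `d = 1`: with `X(s) = x + W(s)` and `τ = T - t`,
`E[exp(-∫ₜᵀ X(s)² ds) | F_t] = sech(√2 τ)^{1/2} · exp(-(X(t)²/√2) tanh(√2 τ))` a.s. -/
theorem cir_bond_price {Ω : Type*} [MeasurableSpace Ω] (P : Measure Ω)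
    [IsProbabilityMeasure P] (W : ℝ → Ω → ℝ) (hW : IsStdBrownian P W)
    (x : ℝ) (t T : ℝ) (ht : 0 ≤ t) (htT : t ≤ T) :
    P[fun ω => Real.exp (-∫ s in t..T, (x + W s ω) ^ 2) | natFilt W t]
      =ᵐ[P] fun ω =>
        (1 / Real.cosh (Real.sqrt 2 * (T - t))) ^ ((1 : ℝ) / 2) *
          Real.exp (-((x + W t ω) ^ 2 / Real.sqrt 2) *
            Real.tanh (Real.sqrt 2 * (T - t))) := by
  have hW' := hW
  obtain ⟨h0, hc, hm, hg, hi⟩ := hW'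
  have hle := natFilt_le W hm t
  rcases htT.eq_or_lt with rfl | hlt
  · simp [condExp_const hle]
  have hτ := sub_pos.2 hlt
  have hst := step_tendsto (T - t) hτ
  have hst0 := tendsto_nhds_of_tendsto_nhdsWithin hst
  set f : Ω → ℝ := fun ω => Real.exp (-∫ s in t..T, (x + W s ω) ^ 2) with hf
  set g : Ω → ℝ := fun ω => (1 / Real.cosh (Real.sqrt 2 * (T - t))) ^ ((1 : ℝ) / 2) *
          Real.exp (-((x + W t ω) ^ 2 / Real.sqrt 2) *
            Real.tanh (Real.sqrt 2 * (T - t))) with hgdef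
  have hlim := fun ω => discF_tendsto W x t T hlt ω (hc ω)
  have hdm : ∀ h c n s, Measurable (fun ω => discF W x h c n s ω) := by
    intro h c n s
    unfold discF
    fun_prop
  have hfm : Measurable f := measurable_of_tendsto_metrizable (fun n => hdm _ _ _ _)
    (tendsto_pi_nhds.2 hlim)
  have hgm : Measurable[natFilt W t] g := by
    refine Measurable.const_mul (Real.measurable_exp.comp ?_) _
    exact ((((natFilt_meas W t).const_add x).pow_const 2).div_const _).neg.mul_const _
  have hf_int : Integrable f P := by
    refine Integrable.of_bound hfm.aestronglyMeasurable 1 (Filter.Eventually.of_forall fun ω => ?_)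
    rw [Real.norm_eq_abs, hf, Real.abs_exp]
    refine Real.exp_le_one_iff.2 (neg_nonpos.2 ?_)
    exact intervalIntegral.integral_nonneg htT fun s _ => sq_nonneg _
  have hg_int : Integrable g P := by
    refine Integrable.of_bound (hgm.mono hle le_rfl).aestronglyMeasurable
      ((1 / Real.cosh (Real.sqrt 2 * (T - t))) ^ ((1 : ℝ) / 2))
      (Filter.Eventually.of_forall fun ω => ?_)
    have hA : 0 ≤ (1 / Real.cosh (Real.sqrt 2 * (T - t))) ^ ((1 : ℝ) / 2) := by
      have := Real.cosh_pos (Real.sqrt 2 * (T - t))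
      positivity
    rw [Real.norm_eq_abs, hgdef, abs_mul, Real.abs_exp, abs_of_nonneg hA]
    refine mul_le_of_le_one_right hA (Real.exp_le_one_iff.2 ?_)
    have : 0 ≤ Real.tanh (Real.sqrt 2 * (T - t)) := by
      rw [Real.tanh_eq_sinh_div_cosh]
      exact div_nonneg (Real.sinh_nonneg_iff.2 (by positivity)) (Real.cosh_pos _).le
    have : 0 ≤ ((x + W t ω) ^ 2 / Real.sqrt 2) * Real.tanh (Real.sqrt 2 * (T - t)) := by positivity
    linarith
  refine (ae_eq_condExp_of_forall_setIntegral_eq hle hf_int (fun s _ _ => hg_int.integrableOn)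
    (fun A hA _ => ?_) hgm.stronglyMeasurable.aestronglyMeasurable).symm
  have hA' : MeasurableSet A := hle _ hA
  set ξ : Ω → ℝ := A.indicator (fun _ => 1) with hξ
  have hξm : Measurable[natFilt W t] ξ := measurable_const.indicator hA
  have hξm' : Measurable ξ := hξm.mono hle le_rfl
  have hξ1 : ∀ ω, |ξ ω| ≤ 1 := by
    intro ω
    by_cases h : ω ∈ A <;> simp [hξ, h]
  have hset : ∀ F : Ω → ℝ, ∫ ω in A, F ω ∂P = ∫ ω, ξ ω * F ω ∂P := by
    intro F
    rw [← integral_indicator hA']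
    congr 1; ext ω
    by_cases h : ω ∈ A <;> simp [hξ, h]
  rw [hset, hset]
  have hcn : ∀ n : ℕ, 0 ≤ (Real.cosh (Real.sqrt 2 * ((T - t) / (n + 1 : ℕ))) - 1) /
      ((T - t) / (n + 1 : ℕ)) := fun n =>
    div_nonneg (by linarith [Real.one_le_cosh (Real.sqrt 2 * ((T - t) / (n + 1 : ℕ)))])
      (by positivity)
  -- limit of the left sides
  have L1 : Filter.Tendsto (fun n : ℕ => ∫ ω, ξ ω * discF W x ((T - t) / (n + 1 : ℕ))
      ((Real.cosh (Real.sqrt 2 * ((T - t) / (n + 1 : ℕ))) - 1) / ((T - t) / (n + 1 : ℕ)))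
      (n + 1) t ω ∂P) Filter.atTop (nhds (∫ ω, ξ ω * f ω ∂P)) := by
    refine tendsto_integral_of_dominated_convergence (fun _ => 1)
      (fun n => (hξm'.mul (hdm _ _ _ _)).aestronglyMeasurable) (integrable_const _)
      (fun n => Filter.Eventually.of_forall fun ω => ?_)
      (Filter.Eventually.of_forall fun ω => (hlim ω).const_mul _)
    rw [Real.norm_eq_abs, abs_mul, discF, Real.abs_exp]
    refine mul_le_one₀ (hξ1 ω) (Real.exp_pos _).le (Real.exp_le_one_iff.2 (neg_nonpos.2 ?_))
    have := hcn n
    positivity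
  have hcosh := Real.cosh_pos (Real.sqrt 2 * (T - t))
  have L2 : Filter.Tendsto (fun n : ℕ => ∫ ω, ξ ω *
      ((1 / Real.cosh (Real.sqrt 2 * (T - t))) ^ ((1 : ℝ) / 2) *
        Real.exp (-((Real.cosh (Real.sqrt 2 * ((T - t) + (T - t) / (n + 1 : ℕ))) -
          Real.cosh (Real.sqrt 2 * (T - t)))
          / (2 * ((T - t) / (n + 1 : ℕ)) * Real.cosh (Real.sqrt 2 * (T - t)))) *
            (x + W t ω) ^ 2)) ∂P) Filter.atTop (nhds (∫ ω, ξ ω * g ω ∂P)) := by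
    refine tendsto_integral_of_dominated_convergence
      (fun _ => (1 / Real.cosh (Real.sqrt 2 * (T - t))) ^ ((1 : ℝ) / 2))
      (fun n => ?_) (integrable_const _)
      (fun n => Filter.Eventually.of_forall fun ω => ?_)
      (Filter.Eventually.of_forall fun ω => ?_)
    · refine Measurable.aestronglyMeasurable ?_
      fun_prop
    · rw [Real.norm_eq_abs, abs_mul, abs_mul, Real.abs_exp,
        abs_of_nonneg (a := (1 / Real.cosh (Real.sqrt 2 * (T - t))) ^ ((1 : ℝ) / 2)) (by positivity)]
      refine (mul_le_of_le_one_left (by positivity) (hξ1 ω)).trans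
        (mul_le_of_le_one_right (by positivity) (Real.exp_le_one_iff.2 ?_))
      have hh : 0 < (T - t) / ((n + 1 : ℕ) : ℝ) := by positivity
      have hmono : Real.cosh (Real.sqrt 2 * (T - t)) ≤
          Real.cosh (Real.sqrt 2 * ((T - t) + (T - t) / ((n + 1 : ℕ) : ℝ))) := by
        rw [Real.cosh_le_cosh, abs_of_nonneg (by positivity), abs_of_nonneg (by positivity)]
        have := Real.sqrt_nonneg 2
        nlinarith
      rw [neg_mul, neg_nonpos]
      exact mul_nonneg (div_nonneg (by linarith) (by positivity)) (sq_nonneg _)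
    · refine Filter.Tendsto.const_mul _ ?_
      rw [hgdef]
      refine Filter.Tendsto.const_mul _ ((Real.continuous_exp.tendsto _).comp ?_)
      have := (((slope_tendsto (T - t)).comp hst).neg).mul_const ((x + W t ω) ^ 2)
      have e : -(Real.tanh (Real.sqrt 2 * (T - t)) / Real.sqrt 2) * (x + W t ω) ^ 2 =
          -((x + W t ω) ^ 2 / Real.sqrt 2) * Real.tanh (Real.sqrt 2 * (T - t)) := by ring
      rw [e] at this
      exact this
  refine tendsto_nhds_unique L2 (L1.congr fun n => ?_)
  have hn : ((n + 1 : ℕ) : ℝ) ≠ 0 := by positivity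
  have hend : ((n + 1 : ℕ) : ℝ) * ((T - t) / ((n + 1 : ℕ) : ℝ)) = T - t := by
    field_simp
  rw [disc_formula P W hW x ((T - t) / ((n + 1 : ℕ) : ℝ)) (by positivity) (n + 1) t ht ξ hξm hξ1,
    hend]
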